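/- Let (K,|·|) be a non-Archimedean nontrivially valued field, n ≥ 2, and let ‖·‖ be a non-Archimedean norm on K^n equivalent to the maximum norm ‖·‖_∞. Then for every x₀ ∈ K^n and every r > 0, the open ball B(x₀,r) = {x ∈ K^n : ‖x−x₀‖ < r} is paradoxical using four pieces with respect to the group IA(K^n,‖·‖) of affine isometries of (K^n,‖·‖). -/

import Mathlib

/-- `v` is a non-Archimedean valuation on the field `K`: it is nonnegative, vanishes
exactly at `0`, is multiplicative, and satisfies the strong triangle inequality. -/
def IsNAVal {K : Type*} [Field K] (v : K → ℝ) : Prop :=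
  (∀ x, 0 ≤ v x) ∧ (∀ x, v x = 0 ↔ x = 0) ∧
    (∀ x y, v (x * y) = v x * v y) ∧ (∀ x y, v (x + y) ≤ max (v x) (v y))

/-- `N` is a non-Archimedean norm on the `K`-vector space `X` with respect to the
valuation `v` on `K`. -/
def IsNANorm {K : Type*} [Field K] (v : K → ℝ) {X : Type*} [AddCommGroup X] [Module K X]
    (N : X → ℝ) : Prop :=
  (∀ x, 0 ≤ N x) ∧ (∀ x, N x = 0 ↔ x = 0) ∧
    (∀ (c : K) (x : X), N (c • x) = v c * N x) ∧ (∀ x y, N (x + y) ≤ max (N x) (N y))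

/-- The maximum norm `‖x‖_∞ = max_i v (x i)` on `K^n`. -/
noncomputable def maxNorm {K : Type*} [Field K] (v : K → ℝ) {n : ℕ} (x : Fin n → K) : ℝ :=
  sSup (Set.range fun i => v (x i))

/-- `f ∈ IA(K^n, N)`: `f` is a surjective affine isometry of `(K^n, N)`. -/
def MemIA {K : Type*} [Field K] {n : ℕ} (N : (Fin n → K) → ℝ)
    (f : (Fin n → K) → Fin n → K) : Prop :=
  (∃ (A : Matrix (Fin n) (Fin n) K) (τ : Fin n → K), ∀ x, f x = A.mulVec x + τ) ∧
    Function.Surjective f ∧ ∀ x y, N (f x - f y) = N (x - y)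

/-- A nonempty set `E ⊆ X` is paradoxical using `r` pieces with respect to the
set `S` of transformations of `X`: there are `m, k ≥ 1` with `m + k = r`,
pairwise disjoint pieces `A₁, …, A_m, B₁, …, B_k ⊆ E` covering `E`, and
transformations `g i, h j ∈ S` such that the images `g i '' A i` partition `E`
and the images `h j '' B j` partition `E`. -/
def ParadoxicalUsing {X : Type*} (S : Set (X → X)) (E : Set X) (r : ℕ) : Prop :=
  ∃ (m k : ℕ), 1 ≤ m ∧ 1 ≤ k ∧ m + k = r ∧
    ∃ (A : Fin m → Set X) (B : Fin k → Set X) (g : Fin m → X → X) (h : Fin k → X → X),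
      (∀ i, g i ∈ S) ∧ (∀ j, h j ∈ S) ∧
      (∀ i, A i ⊆ E) ∧ (∀ j, B j ⊆ E) ∧
      (∀ i i', i ≠ i' → Disjoint (A i) (A i')) ∧
      (∀ j j', j ≠ j' → Disjoint (B j) (B j')) ∧
      (∀ i j, Disjoint (A i) (B j)) ∧
      ((⋃ i, A i) ∪ ⋃ j, B j) = E ∧
      (∀ i i', i ≠ i' → Disjoint (g i '' A i) (g i' '' A i')) ∧
      (⋃ i, g i '' A i) = E ∧
      (∀ j j', j ≠ j' → Disjoint (h j '' B j) (h j' '' B j')) ∧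
      (⋃ j, h j '' B j) = E


def pAct {X : Type*} (a : Bool → Equiv.Perm X) (p : Bool × Bool) (x : X) : X :=
  if p.2 then a p.1 x else (a p.1).symm x

def pHalf {X : Type*} (a : Bool → Equiv.Perm X) (e : X × Bool) (o : Bool) : X × (Bool × Bool) :=
  if o then (e.1, (e.2, false)) else ((a e.2).symm e.1, (e.2, true))

theorem pHalf_inj {X : Type*} (a : Bool → Equiv.Perm X) (e e' : X × Bool) (o o' : Bool)
    (h : pHalf a e o = pHalf a e' o') : e = e' ∧ o = o' := by
  obtain ⟨y, i⟩ := e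
  obtain ⟨y', i'⟩ := e'
  cases o <;> cases o' <;> simp [pHalf] at h
  · obtain ⟨h1, rfl⟩ := h
    simpa using h1
  · simp [h]

theorem pAct_half {X : Type*} (a : Bool → Equiv.Perm X) (e : X × Bool) (o : Bool) :
    pAct a (pHalf a e o).2 (pHalf a e o).1 = (pHalf a e (!o)).1 := by
  cases o <;> simp [pHalf, pAct]

theorem comb {X Γ : Type*} [LinearOrder Γ] (a : Bool → Equiv.Perm X) (f : X → Γ) (M : Γ)
    (h1 : ∀ y, M < f y → ∀ p p' : Bool × Bool, f (pAct a p y) ≤ f y → f (pAct a p' y) ≤ f y → p = p')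
    (h2 : ∀ y, f y ≤ M → ((Finset.univ : Finset (Bool × Bool)).filter
      (fun p => f (pAct a p y) ≤ M)).card ≤ 2) :
    ∃ F : X → X × Bool, Function.Bijective F ∧ ∀ x, (F x).1 = x ∨ (F x).1 = a (F x).2 x := by
  classical
  let bd : X × Bool → Prop := fun e => ∀ o, f (pHalf a e o).1 ≤ M
  obtain ⟨H, Hinj, Ht⟩ : ∃ H : {e // bd e} → X, Function.Injective H ∧
      ∀ e, H e ∈ (Finset.univ : Finset Bool).image (fun o => (pHalf a e.1 o).1) := by
    rw [← Finset.all_card_le_biUnion_card_iff_exists_injective]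
    intro s
    set V := s.biUnion (fun e => (Finset.univ : Finset Bool).image (fun o => (pHalf a e.1 o).1))
    let P : X → Finset (Bool × Bool) := fun y => (Finset.univ : Finset (Bool × Bool)).filter
      (fun p => f (pAct a p y) ≤ M)
    have hV : ∀ x ∈ V, f x ≤ M := by
      intro x hx
      simp only [V, Finset.mem_biUnion, Finset.mem_image] at hx
      obtain ⟨e, -, o, -, rfl⟩ := hx
      exact e.2 o
    have c1 : (s ×ˢ (Finset.univ : Finset Bool)).card ≤ (V.sigma P).card := by
      apply Finset.card_le_card_of_injOn
        (fun q => ⟨(pHalf a q.1.1 q.2).1, (pHalf a q.1.1 q.2).2⟩)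
      · rintro ⟨e, o⟩ hq
        have hq' : e ∈ s := by simpa using hq
        simp only [Finset.coe_sigma, Set.mem_sigma_iff, Finset.mem_coe]
        constructor
        · simp only [V, Finset.mem_biUnion, Finset.mem_image]
          exact ⟨e, hq', o, Finset.mem_univ _, rfl⟩
        · simp only [P, Finset.mem_filter, Finset.mem_univ, true_and]
          rw [pAct_half]
          exact e.2 _
      · rintro ⟨e, o⟩ - ⟨e', o'⟩ - h
        simp only [Sigma.mk.injEq, heq_eq_eq] at h
        obtain ⟨h3, h4⟩ := pHalf_inj a e.1 e'.1 o o' (Prod.ext h.1 h.2)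
        simp [h4, Subtype.ext h3]
    have c2 : (V.sigma P).card ≤ V.card * 2 := by
      rw [Finset.card_sigma]
      exact Finset.sum_le_card_nsmul _ _ _ (fun x hx => h2 x (hV x hx))
    rw [Finset.card_product] at c1
    simp only [Finset.card_univ, Fintype.card_bool] at c1
    change s.card ≤ V.card
    omega
  have hi : ∀ e, ¬ bd e → ∃ o, M < f (pHalf a e o).1 ∧ f (pHalf a e (!o)).1 ≤ f (pHalf a e o).1 := by
    intro e he
    simp only [bd, not_forall, not_le] at he
    obtain ⟨o, ho⟩ := he
    rcases le_total (f (pHalf a e (!o)).1) (f (pHalf a e o).1) with h | h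
    · exact ⟨o, ho, h⟩
    · exact ⟨!o, ho.trans_le h, by simpa using h⟩
  choose! O hO1 hO2 using hi
  let G : X × Bool → X := fun e => if h : bd e then H ⟨e, h⟩ else (pHalf a e (O e)).1
  have hGb : ∀ e (h : bd e), f (G e) ≤ M := by
    intro e h
    simp only [G, h, dite_true]
    have := Ht ⟨e, h⟩
    simp only [Finset.mem_image] at this
    obtain ⟨o, -, ho⟩ := this
    rw [← ho]; exact h o
  have hGu : ∀ e (h : ¬ bd e), M < f (G e) := by
    intro e h
    simp only [G, h, dite_false]
    exact hO1 e h
  have hG : ∀ e, ∃ o, G e = (pHalf a e o).1 := by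
    intro e
    by_cases h : bd e
    · have := Ht ⟨e, h⟩
      simp only [Finset.mem_image] at this
      obtain ⟨o, -, ho⟩ := this
      exact ⟨o, by simp only [G, h, dite_true, ← ho]⟩
    · exact ⟨O e, by simp only [G, h, dite_false]⟩
  have Ginj : Function.Injective G := by
    intro e e' hee
    by_cases h : bd e <;> by_cases h' : bd e'
    · simp only [G, h, h', dite_true] at hee
      simpa using Hinj hee
    · exact absurd (hGb e h) (by rw [hee]; exact not_le.2 (hGu e' h'))
    · exact absurd (hGb e' h') (by rw [← hee]; exact not_le.2 (hGu e h))
    · simp only [G, h, h', dite_false] at hee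
      have k1 := hO2 e h
      have k2 := hO2 e' h'
      rw [← pAct_half] at k1 k2
      rw [← hee] at k2
      have := h1 _ (hO1 e h) _ _ k1 k2
      exact (pHalf_inj a e e' _ _ (Prod.ext hee this)).1
  obtain ⟨F, hF, hR⟩ := Function.Embedding.schroeder_bernstein_of_rel
    (f := fun x : X => (x, false)) (g := G) (fun x y h => by simpa using h) Ginj
    (fun x e => e.1 = x ∨ e.1 = a e.2 x) (by simp) (by
      intro e
      obtain ⟨o, ho⟩ := hG e
      rw [ho]
      cases o <;> simp [pHalf])
  exact ⟨F, hF, hR⟩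

theorem val_exists {K : Type*} [Field K] (d : K) (hd : ¬ IsIntegral ℤ d) :
    ∃ R : ValuationSubring K, 1 < R.valuation d := by
  by_contra hcon
  push Not at hcon
  apply hd
  have h := iInf_valuationSubring_superset (K := K) (s := ∅)
  have hd' : d ∈ (⨅ V : {V : ValuationSubring K // (∅ : Set K) ⊆ V.toSubring}, V.1.toSubring) := by
    rw [Subring.mem_iInf]
    intro V
    exact (V.1.valuation_le_one_iff d).1 (hcon V.1)
  rw [h] at hd'
  have h3 : IsIntegral (Subring.closure (∅ : Set K)) d := hd'
  rw [Subring.closure_empty] at h3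
  obtain ⟨p, hp, hpe⟩ := h3
  have hs : Function.Surjective (Int.castRingHom (⊥ : Subring K)) := by
    rintro ⟨x, hx⟩
    obtain ⟨m, rfl⟩ := Subring.mem_bot.1 hx
    exact ⟨m, by ext; simp⟩
  obtain ⟨q, hq, -, hqm⟩ := Polynomial.lifts_and_degree_eq_and_monic
    (f := Int.castRingHom (⊥ : Subring K)) ((Polynomial.lifts_iff_coeff_lifts _).2 fun n => hs _) hp
  refine ⟨q, hqm, ?_⟩
  rw [← hq, Polynomial.eval₂_map] at hpe
  rw [RingHom.ext_int ((algebraMap (⊥ : Subring K) K).comp (Int.castRingHom _)) (algebraMap ℤ K)] at hpe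
  exact hpe

theorem pair_cases (S : Bool × Bool → Prop) (p q : Bool × Bool) (h : p ≠ q) (hp : S p) (hq : S q) :
    ((S (false, true) ∧ S (false, false)) ∨ (S (false, true) ∧ S (true, true)) ∨
      (S (false, true) ∧ S (true, false)) ∨ (S (true, true) ∧ S (true, false))) ∨
    ((S (false, false) ∧ S (false, true)) ∨ (S (false, false) ∧ S (true, false)) ∨
      (S (false, false) ∧ S (true, true)) ∨ (S (true, false) ∧ S (true, true))) := by
  rcases p with ⟨_ | _, _ | _⟩ <;> rcases q with ⟨_ | _, _ | _⟩ <;> simp_all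

theorem triple_cases (S : Bool × Bool → Prop) (p q u : Bool × Bool) (h : p ≠ q) (h' : p ≠ u)
    (h'' : q ≠ u) (hp : S p) (hq : S q) (hu : S u) :
    ((S (false, true) ∧ S (false, false) ∧ S (true, true)) ∨
      (S (false, true) ∧ S (true, true) ∧ S (true, false))) ∨
    ((S (false, false) ∧ S (false, true) ∧ S (true, false)) ∨
      (S (false, false) ∧ S (true, false) ∧ S (true, true))) := by
  rcases p with ⟨_ | _, _ | _⟩ <;> rcases q with ⟨_ | _, _ | _⟩ <;>
    rcases u with ⟨_ | _, _ | _⟩ <;> simp_all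

theorem geo_pair {K : Type*} [Field K] (Q : AddSubgroup K) (d e x y s t : K)
    (h1 : ∀ z, d * z ∈ Q → z ∈ Q) (h2 : ∀ z, (1 - d ^ 2) * z ∈ Q → z ∈ Q)
    (hs : s = x + d * y - (1 + d) * e) (ht : t = d * x + y - (1 + d) * e)
    (he : d ^ 2 * e ∈ Q)
    (h : (d ^ 2 * x ∈ Q ∧ d ^ 2 * y ∈ Q) ∨ (d ^ 2 * x ∈ Q ∧ d ^ 2 * s ∈ Q) ∨
      (d ^ 2 * x ∈ Q ∧ d ^ 2 * t ∈ Q) ∨ (d ^ 2 * s ∈ Q ∧ d ^ 2 * t ∈ Q)) :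
    x ∈ Q ∧ y ∈ Q ∧ s ∈ Q ∧ t ∈ Q := by
  have k1 : ∀ z, d ^ 2 * z ∈ Q → d * z ∈ Q := fun z hz => h1 _ (by convert hz using 1; ring)
  have k0 : ∀ z, d ^ 2 * z ∈ Q → z ∈ Q := fun z hz => h1 _ (k1 z hz)
  have e1 := k1 e he
  have e0 := k0 e he
  rcases h with ⟨hx, hy⟩ | ⟨hx, hs'⟩ | ⟨hx, ht'⟩ | ⟨hs', ht'⟩
  · refine ⟨k0 x hx, k0 y hy, ?_, ?_⟩
    · have : s = x + d * y - e - d * e := by rw [hs]; ring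
      rw [this]
      exact Q.sub_mem (Q.sub_mem (Q.add_mem (k0 x hx) (k1 y hy)) e0) e1
    · have : t = d * x + y - e - d * e := by rw [ht]; ring
      rw [this]
      exact Q.sub_mem (Q.sub_mem (Q.add_mem (k1 x hx) (k0 y hy)) e0) e1
  · have y1 : d * y ∈ Q := by
      have : d * y = s - x + e + d * e := by rw [hs]; ring
      rw [this]
      exact Q.add_mem (Q.add_mem (Q.sub_mem (k0 s hs') (k0 x hx)) e0) e1
    refine ⟨k0 x hx, h1 y y1, k0 s hs', ?_⟩
    have : t = d * x + y - e - d * e := by rw [ht]; ring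
    rw [this]
    exact Q.sub_mem (Q.sub_mem (Q.add_mem (k1 x hx) (h1 y y1)) e0) e1
  · have y1 : d * y ∈ Q := by
      have : d * y = d * t - d ^ 2 * x + d * e + d ^ 2 * e := by rw [ht]; ring
      rw [this]
      exact Q.add_mem (Q.add_mem (Q.sub_mem (k1 t ht') hx) e1) he
    refine ⟨k0 x hx, h1 y y1, ?_, k0 t ht'⟩
    have : s = x + d * y - e - d * e := by rw [hs]; ring
    rw [this]
    exact Q.sub_mem (Q.sub_mem (Q.add_mem (k0 x hx) y1) e0) e1
  · refine ⟨h2 x ?_, h2 y ?_, k0 s hs', k0 t ht'⟩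
    · have : (1 - d ^ 2) * x = e - d ^ 2 * e + s - d * t := by rw [hs, ht]; ring
      rw [this]
      exact Q.sub_mem (Q.add_mem (Q.sub_mem e0 he) (k0 s hs')) (k1 t ht')
    · have : (1 - d ^ 2) * y = e - d ^ 2 * e + t - d * s := by rw [hs, ht]; ring
      rw [this]
      exact Q.sub_mem (Q.add_mem (Q.sub_mem e0 he) (k0 t ht')) (k1 s hs')

theorem geo_triple {K : Type*} [Field K] (Q : AddSubgroup K) (d e x y s t : K)
    (h1 : ∀ z, d * z ∈ Q → z ∈ Q)
    (hs : s = x + d * y - (1 + d) * e) (ht : t = d * x + y - (1 + d) * e)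
    (he : d * e ∈ Q)
    (h : (d ^ 2 * x ∈ Q ∧ d ^ 2 * y ∈ Q ∧ d ^ 2 * s ∈ Q) ∨
      (d ^ 2 * x ∈ Q ∧ d ^ 2 * s ∈ Q ∧ d ^ 2 * t ∈ Q)) :
    d ^ 2 * e ∈ Q := by
  have k1 : ∀ z, d ^ 2 * z ∈ Q → d * z ∈ Q := fun z hz => h1 _ (by convert hz using 1; ring)
  have k0 : ∀ z, d ^ 2 * z ∈ Q → z ∈ Q := fun z hz => h1 _ (k1 z hz)
  rcases h with ⟨hx, hy, hs'⟩ | ⟨hx, hs', ht'⟩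
  · have : d ^ 2 * e = d * x + d ^ 2 * y - d * s - d * e := by rw [hs]; ring
    rw [this]
    exact Q.sub_mem (Q.sub_mem (Q.add_mem (k1 x hx) hy) (k1 s hs')) he
  · have : d ^ 2 * e = e - x + d ^ 2 * x + s - d * t := by rw [hs, ht]; ring
    rw [this]
    exact Q.sub_mem (Q.add_mem (Q.add_mem (Q.sub_mem (h1 e he) (k0 x hx)) hx) (k0 s hs')) (k1 t ht')

/-- strict ball as additive subgroup -/
def wBall {K Γ : Type*} [Field K] [LinearOrderedCommGroupWithZero Γ] (w : Valuation K Γ)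
    (B : Γ) (hB : 0 < B) : AddSubgroup K where
  carrier := {z | w z < B}
  add_mem' := fun {a b} ha hb => lt_of_le_of_lt (w.map_add a b) (max_lt ha hb)
  zero_mem' := by simpa using hB
  neg_mem' := fun {a} ha => by simpa [Valuation.map_neg] using ha

theorem geo {K Γ X : Type*} [Field K] [LinearOrderedCommGroupWithZero Γ] (w : Valuation K Γ)
    (a : Bool → Equiv.Perm X) (co : Bool × Bool → X → K) (d e l : K) (hd : 1 < w d) (he : e ≠ 0)
    (hl : w (d ^ 2) < w l)
    (hs : ∀ P, co (true, true) P = co (false, true) P + d * co (false, false) P - (1 + d) * e)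
    (ht : ∀ P, co (true, false) P = d * co (false, true) P + co (false, false) P - (1 + d) * e)
    (hact : ∀ p P, co p (pAct a p P) = l * co p P) :
    ∃ F : X → X × Bool, Function.Bijective F ∧ ∀ x, (F x).1 = x ∨ (F x).1 = a (F x).2 x := by
  classical
  have hd0 : d ≠ 0 := by rintro rfl; simp at hd
  have hwd : 0 < w d := zero_lt_one.trans hd
  have hd2 : 1 < w (d ^ 2) := by rw [map_pow]; exact one_lt_pow₀ hd two_ne_zero
  have h1d : w (1 - d ^ 2) = w (d ^ 2) := by
    rw [Valuation.map_sub_swap]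
    apply Valuation.map_sub_eq_of_lt_left
    simpa only [map_one] using hd2
  have grow : ∀ u z : K, 1 ≤ w u → w z ≤ w (u * z) := by
    intro u z hu
    rw [map_mul]; exact le_mul_of_one_le_left' hu
  let f : X → Γ := fun P => (Finset.univ : Finset (Bool × Bool)).sup' Finset.univ_nonempty
    (fun p => w (co p P))
  have hf : ∀ p P, w (co p P) ≤ f P := fun p P => by
    exact Finset.le_sup' (fun p => w (co p P)) (Finset.mem_univ p)
  have hM : 0 < w (d ^ 2 * e) := by
    rw [Valuation.pos_iff]; exact mul_ne_zero (pow_ne_zero _ hd0) he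
  have small : ∀ (B : Γ) (hB : 0 < B) p P, f (pAct a p P) ≤ B → d ^ 2 * co p P ∈ wBall w B hB := by
    intro B hB p P h
    change w (d ^ 2 * co p P) < B
    have h3 : w (l * co p P) ≤ B := by rw [← hact]; exact (hf p _).trans h
    by_cases hz : co p P = 0
    · simpa [hz] using hB
    · refine lt_of_lt_of_le ?_ h3
      rw [map_mul, map_mul]
      exact mul_lt_mul_of_pos_right hl (w.pos_iff.2 hz)
  have q1 : ∀ (B : Γ) (hB : 0 < B) z, d * z ∈ wBall w B hB → z ∈ wBall w B hB :=
    fun B hB z hz => lt_of_le_of_lt (grow d z hd.le) hz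
  have q2 : ∀ (B : Γ) (hB : 0 < B) z, (1 - d ^ 2) * z ∈ wBall w B hB → z ∈ wBall w B hB :=
    fun B hB z hz => lt_of_le_of_lt (grow _ z (by rw [h1d]; exact hd2.le)) hz
  apply comb a f (w (d ^ 2 * e))
  · intro P hP p p' hp hp'
    by_contra hne
    have hB : 0 < f P := hM.trans hP
    have m := small _ hB p P hp
    have m' := small _ hB p' P hp'
    have main : co (false, true) P ∈ wBall w _ hB ∧ co (false, false) P ∈ wBall w _ hB ∧
        co (true, true) P ∈ wBall w _ hB ∧ co (true, false) P ∈ wBall w _ hB := by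
      have G1 := geo_pair (wBall w _ hB) d e (co (false, true) P) (co (false, false) P)
        (co (true, true) P) (co (true, false) P) (q1 _ hB) (q2 _ hB) (hs P) (ht P) hP
      have G2 := geo_pair (wBall w _ hB) d e (co (false, false) P) (co (false, true) P)
        (co (true, false) P) (co (true, true) P) (q1 _ hB) (q2 _ hB)
        (by rw [ht]; ring) (by rw [hs]; ring) hP
      clear hp hp' small q1 q2
      rcases pair_cases (fun p => d ^ 2 * co p P ∈ wBall w _ hB) p p' hne m m' with h | h
      · exact G1 h
      · obtain ⟨u1, u2, u3, u4⟩ := G2 h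
        exact ⟨u2, u1, u4, u3⟩
    obtain ⟨p0, -, hp0⟩ := Finset.exists_mem_eq_sup' (Finset.univ_nonempty (α := Bool × Bool))
      (fun p => w (co p P))
    have hlt : w (co p0 P) < f P := by
      rcases p0 with ⟨_ | _, _ | _⟩
      · exact main.2.1
      · exact main.1
      · exact main.2.2.2
      · exact main.2.2.1
    exact absurd hp0 hlt.ne'
  · intro P hP
    by_contra hcard
    push Not at hcard
    have m := fun p => small _ hM p P
    have hnot : d ^ 2 * e ∉ wBall w _ hM := fun h => lt_irrefl _ (show w (d ^ 2 * e) < _ from h)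
    have he1 : d * e ∈ wBall w _ hM := by
      change w (d * e) < w (d ^ 2 * e)
      rw [pow_two, mul_assoc, map_mul w d (d * e)]
      refine lt_mul_of_one_lt_left (w.pos_iff.2 (mul_ne_zero hd0 he)) hd
    have G1 := geo_triple (wBall w _ hM) d e (co (false, true) P) (co (false, false) P)
        (co (true, true) P) (co (true, false) P) (q1 _ hM) (hs P) (ht P) he1
    have G2 := geo_triple (wBall w _ hM) d e (co (false, false) P) (co (false, true) P)
        (co (true, false) P) (co (true, true) P) (q1 _ hM) (by rw [ht]; ring) (by rw [hs]; ring) he1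
    obtain ⟨p1, p2, p3, m1, m2, m3, n12, n13, n23⟩ := Finset.two_lt_card_iff.1 hcard
    have m1' := m p1 (by simpa using m1)
    have m2' := m p2 (by simpa using m2)
    have m3' := m p3 (by simpa using m3)
    clear m m1 m2 m3 small q1 q2 hcard
    apply hnot
    rcases triple_cases (fun p => d ^ 2 * co p P ∈ wBall w _ hM) p1 p2 p3 n12 n13 n23 m1' m2' m3'
      with h | h
    · exact G1 h
    · exact G2 h

theorem nav_one {K : Type*} [Field K] {v : K → ℝ} (hv : IsNAVal v) : v 1 = 1 := by
  obtain ⟨h0, h1, h2, h3⟩ := hv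
  have h := h2 1 1
  have : v 1 ≠ 0 := fun h => one_ne_zero ((h1 1).1 h)
  rw [mul_one] at h
  exact (mul_right_cancel₀ this (by rw [one_mul]; exact h)).symm

theorem nav_neg {K : Type*} [Field K] {v : K → ℝ} (hv : IsNAVal v) (x : K) : v (-x) = v x := by
  have h1 := nav_one hv
  obtain ⟨h0, h1', h2, h3⟩ := hv
  have h := h2 (-1) (-1)
  rw [neg_mul_neg, mul_one, h1] at h
  have : v (-1) = 1 := by nlinarith [h0 (-1)]
  rw [← neg_one_mul, h2, this, one_mul]

theorem nav_inv {K : Type*} [Field K] {v : K → ℝ} (hv : IsNAVal v) (x : K) : v x⁻¹ = (v x)⁻¹ := by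
  by_cases hx : x = 0
  · subst hx; simp [(hv.2.1 0).2 rfl]
  · apply eq_inv_of_mul_eq_one_left
    rw [← hv.2.2.1, inv_mul_cancel₀ hx, nav_one hv]

theorem nav_pow {K : Type*} [Field K] {v : K → ℝ} (hv : IsNAVal v) (x : K) (k : ℕ) :
    v (x ^ k) = v x ^ k := by
  induction k with
  | zero => simp [nav_one hv]
  | succ k ih => rw [pow_succ, hv.2.2.1, ih, pow_succ]

theorem nav_sub {K : Type*} [Field K] {v : K → ℝ} (hv : IsNAVal v) (x y : K) :
    v (x - y) ≤ max (v x) (v y) := by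
  rw [sub_eq_add_neg, ← nav_neg hv y]; exact hv.2.2.2 _ _

/-- adding something small does not change the valuation -/
theorem nav_add_lt {K : Type*} [Field K] {v : K → ℝ} (hv : IsNAVal v) (x y : K) (h : v y < v x) :
    v (x + y) = v x := by
  apply le_antisymm
  · exact (hv.2.2.2 _ _).trans (max_le le_rfl h.le)
  · have := nav_sub hv (x + y) y
    rw [add_sub_cancel_right] at this
    rcases le_max_iff.1 this with h' | h'
    · exact h'
    · exact absurd h (not_lt.2 h')

theorem nav_nat {K : Type*} [Field K] {v : K → ℝ} (hv : IsNAVal v) (m : ℕ) : v (m : K) ≤ 1 := by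
  induction m with
  | zero => simp [(hv.2.1 0).2 rfl]
  | succ k ih =>
    push_cast
    exact (hv.2.2.2 _ _).trans (max_le ih (nav_one hv).le)

theorem nav_int {K : Type*} [Field K] {v : K → ℝ} (hv : IsNAVal v) (m : ℤ) : v (m : K) ≤ 1 := by
  obtain ⟨k, rfl | rfl⟩ := m.eq_nat_or_neg
  · simpa using nav_nat hv k
  · simpa [nav_neg hv] using nav_nat hv k

open Polynomial in
theorem nav_poly {K : Type*} [Field K] {v : K → ℝ} (hv : IsNAVal v) (d : K) (hd : d ≠ 0)
    (hd1 : v d < 1) (hz : ∀ m : ℤ, v (m : K) < 1 → (m : K) = 0) (n : ℕ) :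
    ∀ p : ℤ[X], p.natDegree ≤ n →
    v (aeval d p) ≤ 1 ∧ (p.map (Int.castRingHom K) ≠ 0 → aeval d p ≠ 0) := by
  have hC : ∀ m : ℤ, v (aeval d (C m : ℤ[X])) ≤ 1 := by
    intro m; simpa using nav_int hv m
  induction n with
  | zero =>
    intro p hp
    rw [natDegree_le_iff_degree_le] at hp
    rw [eq_C_of_degree_le_zero hp]
    refine ⟨hC _, ?_⟩
    intro h h'
    apply h
    rw [aeval_C, algebraMap_int_eq, eq_intCast] at h'
    rw [map_C, eq_intCast, h', C_0]
  | succ n ih =>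
    intro p hp
    obtain ⟨i1, i2⟩ := ih p.divX (by rw [natDegree_divX_eq_natDegree_tsub_one]; omega)
    have hlt : v (aeval d p.divX * d) < 1 := by
      rw [hv.2.2.1]
      calc _ ≤ 1 * v d := mul_le_mul_of_nonneg_right i1 (hv.1 _)
        _ < 1 := by simpa using hd1
    have hpe : aeval d p = aeval d p.divX * d + ((p.coeff 0 : ℤ) : K) := by
      conv_lhs => rw [← divX_mul_X_add p]
      simp
    constructor
    · rw [hpe]
      exact (hv.2.2.2 _ _).trans (max_le hlt.le (nav_int hv _))
    · intro hne h0
      rw [hpe] at h0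
      by_cases hc : ((p.coeff 0 : ℤ) : K) = 0
      · rw [hc, add_zero] at h0
        refine i2 ?_ ((mul_eq_zero.1 h0).resolve_right hd)
        intro h
        apply hne
        conv_lhs => rw [← divX_mul_X_add p]
        rw [Polynomial.map_add, Polynomial.map_mul, h, zero_mul, zero_add, map_C, eq_intCast, hc, C_0]
      · apply hc
        apply hz
        rw [eq_neg_of_add_eq_zero_right h0, nav_neg hv]
        exact hlt

theorem nav_nonint {K : Type*} [Field K] {v : K → ℝ} (hv : IsNAVal v)
    (hnt : ∃ c : K, c ≠ 0 ∧ v c ≠ 1) : ∃ d : K, d ≠ 0 ∧ v d < 1 ∧ ¬ IsIntegral ℤ d := by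
  by_cases hz : ∀ m : ℤ, v (m : K) < 1 → (m : K) = 0
  · obtain ⟨d, hd, hd1⟩ : ∃ d : K, d ≠ 0 ∧ v d < 1 := by
      obtain ⟨c, hc, hc1⟩ := hnt
      rcases lt_or_gt_of_ne hc1 with h | h
      · exact ⟨c, hc, h⟩
      · refine ⟨c⁻¹, inv_ne_zero hc, ?_⟩
        rw [nav_inv hv]
        exact inv_lt_one_of_one_lt₀ h
    refine ⟨d, hd, hd1, ?_⟩
    rintro ⟨p, hp, hpe⟩
    refine (nav_poly hv d hd hd1 hz p.natDegree p le_rfl).2 ?_ hpe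
    exact (hp.map _).ne_zero
  · push Not at hz
    obtain ⟨m, hm, hm0⟩ : ∃ m : ℕ, v (m : K) < 1 ∧ (m : K) ≠ 0 := by
      obtain ⟨m, hm, hm0⟩ := hz
      obtain ⟨k, rfl | rfl⟩ := m.eq_nat_or_neg
      · exact ⟨k, by simpa using hm, by simpa using hm0⟩
      · exact ⟨k, by simpa [nav_neg hv] using hm, by simpa using hm0⟩
    have hchar : CharZero K := by
      obtain ⟨p, hp⟩ := CharP.exists K
      rcases CharP.char_is_prime_or_zero K p with h | h
      · exfalso
        have : Fact p.Prime := ⟨h⟩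
        have hco : IsCoprime (m : ℤ) (p : ℤ) := by
          rw [Nat.isCoprime_iff_coprime, Nat.coprime_comm, h.coprime_iff_not_dvd]
          intro hd
          exact hm0 ((CharP.cast_eq_zero_iff K p m).2 hd)
        obtain ⟨a, b, hab⟩ := hco
        have := congrArg (Int.cast : ℤ → K) hab
        push_cast at this
        rw [CharP.cast_eq_zero K p, mul_zero, add_zero] at this
        have h2 : v ((a : K) * m) < 1 := by
          rw [hv.2.2.1]
          calc _ ≤ 1 * v (m : K) := mul_le_mul_of_nonneg_right (nav_int hv a) (hv.1 _)
            _ < 1 := by simpa using hm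
        rw [this, nav_one hv] at h2
        exact lt_irrefl _ h2
      · subst h
        exact CharP.charP_to_charZero K
    have hm1 : (m + 1 : K) ≠ 0 := by exact_mod_cast Nat.succ_ne_zero m
    have hv1 : v (m + 1 : K) = 1 := by
      rw [add_comm, nav_add_lt hv, nav_one hv]
      rwa [nav_one hv]
    refine ⟨(m : K) / (m + 1), div_ne_zero hm0 hm1, ?_, ?_⟩
    · rw [div_eq_mul_inv, hv.2.2.1, nav_inv hv, hv1]; simpa using hm
    · intro h
      have e : (m : K) / (m + 1) = algebraMap ℚ K ((m : ℚ) / (m + 1)) := by simp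
      rw [e, isIntegral_algebraMap_iff (algebraMap ℚ K).injective] at h
      obtain ⟨z, hz⟩ := IsIntegrallyClosed.isIntegral_iff.1 h
      have hz' : (z : ℚ) * (m + 1) = m := by
        have : (m + 1 : ℚ) ≠ 0 := by exact_mod_cast Nat.succ_ne_zero m
        simp at hz
        rw [hz]; field_simp
      have hz2 : z * ((m : ℤ) + 1) = m := by exact_mod_cast hz'
      have hmp : 0 < m := by
        rcases Nat.eq_zero_or_pos m with h | h
        · subst h; simp at hm0
        · exact h
      rcases le_or_gt z 0 with h | h
      · nlinarith
      · nlinarith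

theorem parad {X : Type*} (S : Set (X → X)) (E : Set X) (a : Bool → Equiv.Perm X)
    (hid : id ∈ S) (ha : ∀ i, ⇑(a i) ∈ S) (hE : ∀ i x, a i x ∈ E ↔ x ∈ E)
    (F : X → X × Bool) (hF : Function.Bijective F)
    (hR : ∀ x, (F x).1 = x ∨ (F x).1 = a (F x).2 x) : ParadoxicalUsing S E 4 := by
  let P : Bool → Fin 2 → Set X := fun i =>
    ![{x | x ∈ E ∧ F x = (x, i)}, {x | x ∈ E ∧ (F x).2 = i ∧ (F x).1 ≠ x}]
  let g : Bool → Fin 2 → X → X := fun i => ![id, a i]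
  have hP : ∀ i k x, x ∈ P i k → x ∈ E ∧ F x = (g i k x, i) ∧ (k = 0 ↔ (F x).1 = x) := by
    intro i k x hx
    fin_cases k
    · obtain ⟨h1, h2⟩ : x ∈ E ∧ F x = (x, i) := hx
      simp [g, h1, h2]
    · obtain ⟨h1, h2, h3⟩ : x ∈ E ∧ (F x).2 = i ∧ (F x).1 ≠ x := hx
      have h4 := (hR x).resolve_left h3
      rw [h2] at h4
      exact ⟨h1, Prod.ext h4 h2, by simp [h3]⟩
  have hP2 : ∀ i x, x ∈ E → (F x).2 = i → ∃ k, x ∈ P i k := by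
    intro i x hx hi
    by_cases h : (F x).1 = x
    · exact ⟨0, hx, Prod.ext h hi⟩
    · exact ⟨1, hx, hi, h⟩
  have hg : ∀ i k x, g i k x ∈ E ↔ x ∈ E := by
    intro i k x
    fin_cases k
    · simp [g]
    · simpa [g] using hE i x
  have hgS : ∀ i k, g i k ∈ S := by
    intro i k
    fin_cases k
    · exact hid
    · exact ha i
  have hdis : ∀ i k k', k ≠ k' → Disjoint (P i k) (P i k') := by
    intro i k k' hk
    rw [Set.disjoint_left]
    intro x h1 h2
    have h3 := (hP _ _ _ h1).2.2
    have h4 := (hP _ _ _ h2).2.2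
    apply hk
    rw [← h4] at h3
    omega
  have hdis2 : ∀ i k k', k ≠ k' → Disjoint (g i k '' P i k) (g i k' '' P i k') := by
    intro i k k' hk
    rw [Set.disjoint_left]
    rintro _ ⟨x, h1, rfl⟩ ⟨y, h2, h3⟩
    have e1 := (hP _ _ _ h1).2.1
    have e2 := (hP _ _ _ h2).2.1
    rw [h3, ← e1] at e2
    have := hF.1 e2
    subst this
    exact Set.disjoint_left.1 (hdis i k k' hk) h1 h2
  have hun : ∀ i, (⋃ k, g i k '' P i k) = E := by
    intro i
    ext y
    simp only [Set.mem_iUnion, Set.mem_image]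
    constructor
    · rintro ⟨k, x, hx, rfl⟩
      exact (hg i k x).2 (hP _ _ _ hx).1
    · intro hy
      obtain ⟨x, hx⟩ := hF.2 (y, i)
      have hxE : x ∈ E := by
        rcases hR x with h | h
        · rw [← h, hx]; exact hy
        · rw [← hE (F x).2 x, ← h, hx]; exact hy
      obtain ⟨k, hk⟩ := hP2 i x hxE (by rw [hx])
      refine ⟨k, x, hk, ?_⟩
      have := (hP _ _ _ hk).2.1
      rw [hx] at this
      exact (congrArg Prod.fst this).symm
  refine ⟨2, 2, by norm_num, by norm_num, by norm_num, P false, P true, g false, g true,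
    hgS _, hgS _, fun k x hx => (hP _ _ _ hx).1, fun k x hx => (hP _ _ _ hx).1, hdis _, hdis _,
    ?_, ?_, hdis2 _, hun _, hdis2 _, hun _⟩
  · intro k k'
    rw [Set.disjoint_left]
    intro x h1 h2
    have e1 := (hP _ _ _ h1).2.1
    have e2 := (hP _ _ _ h2).2.1
    rw [e1] at e2
    simpa using congrArg Prod.snd e2
  · ext x
    simp only [Set.mem_union, Set.mem_iUnion]
    constructor
    · rintro (⟨k, hk⟩ | ⟨k, hk⟩)
      · exact (hP _ _ _ hk).1
      · exact (hP _ _ _ hk).1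
    · intro hx
      cases h : (F x).2
      · exact Or.inl (hP2 _ x hx h)
      · exact Or.inr (hP2 _ x hx h)

/-- identity plus a perturbation in two coordinates -/
def pT {K : Type*} [Field K] {n : ℕ} (i0 i1 : Fin n) (α β γ δ : K) :
    (Fin n → K) →ₗ[K] (Fin n → K) where
  toFun x := x + Pi.single i0 (α * x i0 + β * x i1) + Pi.single i1 (γ * x i0 + δ * x i1)
  map_add' x y := by
    ext i
    simp only [Pi.add_apply, Pi.single_apply]
    split_ifs <;> ring
  map_smul' c x := by
    ext i
    simp only [Pi.add_apply, Pi.single_apply, Pi.smul_apply, smul_eq_mul, RingHom.id_apply]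
    split_ifs <;> ring

theorem le_maxNorm {K : Type*} [Field K] (v : K → ℝ) {n : ℕ} (x : Fin n → K) (i : Fin n) :
    v (x i) ≤ maxNorm v x :=
  le_csSup (Set.finite_range _).bddAbove ⟨i, rfl⟩

theorem maxNorm_le {K : Type*} [Field K] (v : K → ℝ) {n : ℕ} (i0 : Fin n) (x : Fin n → K) (B : ℝ)
    (h : ∀ i, v (x i) ≤ B) : maxNorm v x ≤ B := by
  haveI : Nonempty (Fin n) := ⟨i0⟩
  apply csSup_le (Set.range_nonempty _)
  rintro _ ⟨i, rfl⟩
  exact h i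

theorem pT_iso {K : Type*} [Field K] {v : K → ℝ} (hv : IsNAVal v) {n : ℕ} {N : (Fin n → K) → ℝ}
    (hN : IsNANorm v N) (C₁ C₂ : ℝ) (h2 : 0 < C₂)
    (heq : ∀ x : Fin n → K, C₁ * maxNorm v x ≤ N x ∧ N x ≤ C₂ * maxNorm v x)
    (i0 i1 : Fin n) (h01 : i0 ≠ i1) (α β γ δ : K) (ε : ℝ) (hε : C₂ * ε < C₁)
    (ha : v α ≤ ε) (hb : v β ≤ ε) (hc : v γ ≤ ε) (hd : v δ ≤ ε) (x : Fin n → K) :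
    N (pT i0 i1 α β γ δ x) = N x := by
  have hε0 : 0 ≤ ε := (hv.1 α).trans ha
  have Nneg : ∀ x, N (-x) = N x := by
    intro x
    rw [← neg_one_smul K x, hN.2.2.1, nav_neg hv, nav_one hv, one_mul]
  by_cases hx : x = 0
  · rw [hx, map_zero]
  have hNx : 0 < N x := lt_of_le_of_ne (hN.1 x) (fun h => hx ((hN.2.1 x).1 h.symm))
  set y : Fin n → K := Pi.single i0 (α * x i0 + β * x i1) + Pi.single i1 (γ * x i0 + δ * x i1)
    with hy
  have hT : pT i0 i1 α β γ δ x = x + y := by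
    rw [hy, ← add_assoc]; rfl
  have m0 : 0 ≤ maxNorm v x := (hv.1 _).trans (le_maxNorm v x i0)
  have key : ∀ a b : K, v a ≤ ε → v b ≤ ε → v (a * x i0 + b * x i1) ≤ ε * maxNorm v x := by
    intro a b ha hb
    refine (hv.2.2.2 _ _).trans (max_le ?_ ?_) <;> rw [hv.2.2.1]
    · exact mul_le_mul ha (le_maxNorm v x i0) (hv.1 _) hε0
    · exact mul_le_mul hb (le_maxNorm v x i1) (hv.1 _) hε0
  have hym : maxNorm v y ≤ ε * maxNorm v x := by
    apply maxNorm_le v i0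
    intro i
    rw [hy, Pi.add_apply, Pi.single_apply, Pi.single_apply]
    by_cases hi0 : i = i0
    · have : i ≠ i1 := fun h => h01 (hi0.symm.trans h)
      simp only [hi0, if_true, if_neg h01, add_zero]
      exact key _ _ ha hb
    · by_cases hi1 : i = i1
      · simp only [if_neg hi0, if_pos hi1, zero_add]
        exact key _ _ hc hd
      · simp only [if_neg hi0, if_neg hi1, zero_add, (hv.2.1 0).2 rfl]
        exact mul_nonneg hε0 m0
  have hlt : N y < N x := by
    have e1 := (heq y).2
    have e2 := (heq x).1
    have e3 : C₂ * maxNorm v y ≤ C₂ * (ε * maxNorm v x) := mul_le_mul_of_nonneg_left hym h2.le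
    have mpos : 0 < maxNorm v x := by
      by_contra h
      have : maxNorm v x = 0 := le_antisymm (not_lt.1 h) m0
      have := (heq x).2
      simp_all
      linarith
    nlinarith
  rw [hT]
  apply le_antisymm
  · exact (hN.2.2.2 _ _).trans (max_le le_rfl hlt.le)
  · have := hN.2.2.2 (x + y) (-y)
    rw [add_neg_cancel_right, Nneg] at this
    rcases le_max_iff.1 this with h' | h'
    · exact h'
    · exact absurd hlt (not_lt.2 h')

/-- affine permutation with fixed point `z` -/
def affPerm {K : Type*} [Field K] {n : ℕ} (T : (Fin n → K) ≃ₗ[K] (Fin n → K)) (z : Fin n → K) :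
    Equiv.Perm (Fin n → K) where
  toFun x := z + T (x - z)
  invFun x := z + T.symm (x - z)
  left_inv x := by simp
  right_inv x := by simp

theorem affPerm_mem {K : Type*} [Field K] {n : ℕ} (T : (Fin n → K) ≃ₗ[K] (Fin n → K))
    (z : Fin n → K) (N : (Fin n → K) → ℝ) (hT : ∀ x, N (T x) = N x) : MemIA N (affPerm T z) := by
  refine ⟨⟨LinearMap.toMatrix' T.toLinearMap, z - T z, ?_⟩, (affPerm T z).surjective, ?_⟩
  · intro x
    rw [LinearMap.toMatrix'_mulVec]
    simp only [affPerm, Equiv.coe_fn_mk, map_sub, LinearEquiv.coe_coe]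
    abel
  · intro x y
    rw [← hT (x - y)]
    congr 1
    simp only [affPerm, Equiv.coe_fn_mk, map_sub]
    abel

theorem affPerm_ball {K : Type*} [Field K] {v : K → ℝ} (hv : IsNAVal v) {n : ℕ}
    (T : (Fin n → K) ≃ₗ[K] (Fin n → K))
    (z : Fin n → K) {N : (Fin n → K) → ℝ} (hN : IsNANorm v N) (hT : ∀ x, N (T x) = N x)
    (x₀ : Fin n → K) (r : ℝ) (hz : N (z - x₀) < r) (x : Fin n → K) :
    N (affPerm T z x - x₀) < r ↔ N (x - x₀) < r := by
  have Nneg : ∀ x, N (-x) = N x := by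
    intro x
    rw [← neg_one_smul K x, hN.2.2.1, nav_neg hv, nav_one hv, one_mul]
  have h1 : ∀ y, N (y - x₀) < r ↔ N (y - z) < r := by
    intro y
    constructor
    · intro h
      have := hN.2.2.2 (y - x₀) (-(z - x₀))
      rw [Nneg, show y - x₀ + -(z - x₀) = y - z by abel] at this
      exact this.trans_lt (max_lt h hz)
    · intro h
      have := hN.2.2.2 (y - z) (z - x₀)
      rw [show y - z + (z - x₀) = y - x₀ by abel] at this
      exact this.trans_lt (max_lt h hz)
  rw [h1, h1, ← hT (x - z)]
  simp [affPerm]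

theorem pT_apply0 {K : Type*} [Field K] {n : ℕ} (i0 i1 : Fin n) (h01 : i0 ≠ i1) (α β γ δ : K)
    (x : Fin n → K) : pT i0 i1 α β γ δ x i0 = x i0 + (α * x i0 + β * x i1) := by
  simp [pT, Pi.single_apply, h01]

theorem pT_apply1 {K : Type*} [Field K] {n : ℕ} (i0 i1 : Fin n) (h01 : i0 ≠ i1) (α β γ δ : K)
    (x : Fin n → K) : pT i0 i1 α β γ δ x i1 = x i1 + (γ * x i0 + δ * x i1) := by
  simp [pT, Pi.single_apply, h01.symm]


theorem statement11 {K : Type*} [Field K] (v : K → ℝ) (hv : IsNAVal v)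
    (hnt : ∃ c : K, c ≠ 0 ∧ v c ≠ 1)
    (n : ℕ) (hn : 2 ≤ n) (N : (Fin n → K) → ℝ) (hN : IsNANorm v N)
    -- N is equivalent to the maximum norm
    (heq : ∃ C₁ C₂ : ℝ, 0 < C₁ ∧ 0 < C₂ ∧
      ∀ x : Fin n → K, C₁ * maxNorm v x ≤ N x ∧ N x ≤ C₂ * maxNorm v x)
    (x₀ : Fin n → K) (r : ℝ) (hr : 0 < r) :
    ParadoxicalUsing {f | MemIA N f} {x : Fin n → K | N (x - x₀) < r} 4 := by
  
  obtain ⟨C₁, C₂, h1, h2, heq⟩ := heq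
  obtain ⟨d, hd0, hd1, hint⟩ := nav_nonint hv hnt
  obtain ⟨R, hw⟩ := val_exists d hint
  set w := R.valuation with hwdef
  have hvd : 0 ≤ v d := hv.1 d
  have hvz : v 0 = 0 := (hv.2.1 0).2 rfl
  obtain ⟨k0, hk0⟩ := exists_pow_lt_of_lt_one (div_pos h1 h2) hd1
  obtain ⟨j, hj⟩ := exists_pow_lt_of_lt_one (div_pos hr h2) hd1
  set k := k0 + 3 with hk
  set ε := v d ^ k with hεdef
  have hε : C₂ * ε < C₁ := by
    have : ε ≤ v d ^ k0 := pow_le_pow_of_le_one hvd hd1.le (by omega)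
    rw [mul_comm, ← lt_div_iff₀ h2]
    exact this.trans_lt hk0
  have hε0 : 0 ≤ ε := pow_nonneg hvd _
  have hε1 : ε < 1 := pow_lt_one₀ hvd hd1 (by omega)
  set e : K := d ^ j with he
  have he0 : e ≠ 0 := pow_ne_zero _ hd0
  set l : K := 1 + d ^ k with hl
  have hvk : v (d ^ k) = ε := nav_pow hv d k
  have hvl : v l = 1 := by
    rw [hl, nav_add_lt hv, nav_one hv]
    rw [nav_one hv, hvk]; exact hε1
  have hl0 : l ≠ 0 := by
    intro h; rw [h, hvz] at hvl; exact zero_ne_one hvl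
  have hwl : w (d ^ 2) < w l := by
    have hlt : w (d ^ 2) < w (d ^ k) := by
      rw [map_pow, map_pow]
      exact pow_lt_pow_right₀ hw (by omega)
    have h1' : w 1 < w (d ^ k) := by
      rw [map_one, map_pow]; exact one_lt_pow₀ hw (by omega)
    rw [hl, Valuation.map_add_eq_of_lt_right _ h1']
    exact hlt
  set μ : K := l - 1 with hμ
  set ν : K := l⁻¹ - 1 with hν
  have hvμ : v μ ≤ ε := by rw [hμ, hl, add_sub_cancel_left, hvk]
  have hvν : v ν ≤ ε := by
    have : ν = -(d ^ k) * l⁻¹ := by rw [hν]; field_simp; rw [hl]; ring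
    rw [this, hv.2.2.1, nav_neg hv, nav_inv hv, hvl, hvk]; simp
  have hD : v (1 - d ^ 2) = 1 := by
    rw [sub_eq_add_neg, nav_add_lt hv, nav_one hv]
    rw [nav_neg hv, nav_pow hv, nav_one hv]
    exact pow_lt_one₀ hvd hd1 two_ne_zero
  have hD0 : 1 - d ^ 2 ≠ 0 := by
    intro h; rw [h, hvz] at hD; exact zero_ne_one hD
  -- small coefficients
  have sm : ∀ a b : K, v a ≤ 1 → v b ≤ 1 → v ((a * μ + b * ν) / (1 - d ^ 2)) ≤ ε := by
    intro a b ha hb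
    rw [div_eq_mul_inv, hv.2.2.1, nav_inv hv, hD, inv_one, mul_one]
    refine (hv.2.2.2 _ _).trans (max_le ?_ ?_) <;> rw [hv.2.2.1]
    · calc v a * v μ ≤ 1 * ε := mul_le_mul ha hvμ (hv.1 _) zero_le_one
        _ = ε := one_mul _
    · calc v b * v ν ≤ 1 * ε := mul_le_mul hb hvν (hv.1 _) zero_le_one
        _ = ε := one_mul _
  have v1 : v 1 ≤ 1 := (nav_one hv).le
  have vd : v d ≤ 1 := hd1.le
  have vd' : v (-d) ≤ 1 := by rw [nav_neg hv]; exact vd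
  have vd2 : v (-d ^ 2) ≤ 1 := by
    rw [nav_neg hv, nav_pow hv]; exact pow_le_one₀ hvd vd
  let i0 : Fin n := ⟨0, by omega⟩
  let i1 : Fin n := ⟨1, by omega⟩
  have h01 : i0 ≠ i1 := by
    intro h; simpa [i0, i1] using congrArg Fin.val h
  set LA := pT i0 i1 μ 0 0 ν with hLA
  set LB := pT i0 i1 ((1 * μ + (-d ^ 2) * ν) / (1 - d ^ 2)) ((d * μ + (-d) * ν) / (1 - d ^ 2))
    (((-d) * μ + d * ν) / (1 - d ^ 2)) (((-d ^ 2) * μ + 1 * ν) / (1 - d ^ 2)) with hLB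
  have NA : ∀ x, N (LA x) = N x := pT_iso hv hN C₁ C₂ h2 heq i0 i1 h01 _ _ _ _ ε hε hvμ
    (by rw [hvz]; exact hε0) (by rw [hvz]; exact hε0) hvν
  have NB : ∀ x, N (LB x) = N x := pT_iso hv hN C₁ C₂ h2 heq i0 i1 h01 _ _ _ _ ε hε
    (sm _ _ v1 vd2) (sm _ _ vd vd') (sm _ _ vd' vd) (sm _ _ vd2 v1)
  have inj : ∀ T : (Fin n → K) →ₗ[K] (Fin n → K), (∀ x, N (T x) = N x) → Function.Injective T := by
    intro T hT
    rw [injective_iff_map_eq_zero]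
    intro x hx
    rw [← hN.2.1, ← hT, hx, hN.2.1]
  let TA := LinearEquiv.ofInjectiveEndo LA (inj LA NA)
  let TB := LinearEquiv.ofInjectiveEndo LB (inj LB NB)
  have NA' : ∀ x, N (TA x) = N x := NA
  have NB' : ∀ x, N (TB x) = N x := NB
  set q : Fin n → K := Pi.single i0 e + Pi.single i1 e with hq
  have q0 : q i0 = e := by simp [hq, Pi.single_apply, h01]
  have q1 : q i1 = e := by simp [hq, Pi.single_apply, h01.symm]
  have hNq : N q < r := by
    have hve : v e = v d ^ j := nav_pow hv d j
    have hqm : maxNorm v q ≤ v d ^ j := by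
      apply maxNorm_le v i0
      intro i
      by_cases hi0 : i = i0
      · rw [hi0, q0, hve]
      · by_cases hi1 : i = i1
        · rw [hi1, q1, hve]
        · simp only [hq, Pi.add_apply, Pi.single_apply, if_neg hi0, if_neg hi1, zero_add, hvz]
          exact pow_nonneg hvd _
    calc N q ≤ C₂ * maxNorm v q := (heq q).2
      _ ≤ C₂ * v d ^ j := mul_le_mul_of_nonneg_left hqm h2.le
      _ < r := by rw [mul_comm, ← lt_div_iff₀ h2]; exact hj
  let a : Bool → Equiv.Perm (Fin n → K) := fun b => if b then affPerm TB (x₀ + q) else affPerm TA x₀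
  let co : Bool × Bool → (Fin n → K) → K := fun p P =>
    if p.1 then
      if p.2 then (P i0 - x₀ i0) + d * (P i1 - x₀ i1) - (1 + d) * e
      else d * (P i0 - x₀ i0) + (P i1 - x₀ i1) - (1 + d) * e
    else if p.2 then P i0 - x₀ i0 else P i1 - x₀ i1
  have hA0 : ∀ P, a false P i0 = x₀ i0 + l * (P i0 - x₀ i0) := by
    intro P
    change x₀ i0 + LA (P - x₀) i0 = _
    rw [hLA, pT_apply0 i0 i1 h01, hμ]
    simp only [Pi.sub_apply]; ring
  have hA1 : ∀ P, a false P i1 = x₀ i1 + l⁻¹ * (P i1 - x₀ i1) := by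
    intro P
    change x₀ i1 + LA (P - x₀) i1 = _
    rw [hLA, pT_apply1 i0 i1 h01, hν]
    simp only [Pi.sub_apply]; ring
  have hB0 := fun P : Fin n → K => show a true P i0 = x₀ i0 + q i0 + LB (P - (x₀ + q)) i0 from rfl
  have hB1 := fun P : Fin n → K => show a true P i1 = x₀ i1 + q i1 + LB (P - (x₀ + q)) i1 from rfl
  simp only [hLB, pT_apply0 i0 i1 h01, Pi.sub_apply, Pi.add_apply, q0, q1] at hB0
  simp only [hLB, pT_apply1 i0 i1 h01, Pi.sub_apply, Pi.add_apply, q0, q1] at hB1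
  have up : ∀ i P, co (i, true) (a i P) = l * co (i, true) P := by
    intro i P
    cases i
    · simp only [co, Bool.false_eq_true, if_false, if_true, hA0]; ring
    · simp only [co, if_true, hB0, hB1, hμ]
      field_simp
      ring
  have down : ∀ i P, co (i, false) (a i P) = l⁻¹ * co (i, false) P := by
    intro i P
    cases i
    · simp only [co, Bool.false_eq_true, if_false, hA1]; ring
    · have hν' : l⁻¹ = 1 + ν := by rw [hν]; ring
      rw [hν']
      simp only [co, Bool.false_eq_true, if_false, if_true, hB0, hB1]
      clear_value μ ν
      field_simp
      ring
  have hact : ∀ p P, co p (pAct a p P) = l * co p P := by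
    rintro ⟨i, o⟩ P
    cases o
    · have := down i ((a i).symm P)
      rw [Equiv.apply_symm_apply] at this
      change co (i, false) ((a i).symm P) = _
      rw [this, mul_inv_cancel_left₀ hl0]
    · exact up i P
  obtain ⟨F, hF, hR⟩ := geo w a co d e l hw he0 hwl (fun P => rfl) (fun P => rfl) hact
  refine parad _ _ a ?_ ?_ ?_ F hF hR
  · exact ⟨⟨1, 0, fun x => by simp⟩, Function.surjective_id, fun x y => rfl⟩
  · intro i
    cases i
    · exact affPerm_mem TA _ N NA'
    · exact affPerm_mem TB _ N NB'
  · intro i x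
    cases i
    · refine affPerm_ball hv TA _ hN NA' x₀ r ?_ x
      rw [sub_self, (hN.2.1 0).2 rfl]; exact hr
    · refine affPerm_ball hv TB _ hN NB' x₀ r ?_ x
      rw [add_sub_cancel_left]; exact hNq
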